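/- Spectral splitting of dominant linear systems: let A ∈ ℝ^{n×n}, γ ≥ 0, and let P ∈ ℝ^{n×n} be symmetric with exactly p negative eigenvalues, no zero eigenvalue, and n−p positive eigenvalues, such that Aᵀ P + P A + 2γP is negative definite. Then A has no eigenvalue with real part equal to −γ; counted with algebraic multiplicity, A has exactly p eigenvalues (in ℂ) with real part strictly greater than −γ and exactly n−p eigenvalues with real part strictly less than −γ. -/

import Mathlib

open Matrix

theorem dss_pencil {n : ℕ} (L : (Fin n → ℂ) ≃ₗ[ℂ] (Fin n → ℂ)) (M : (Fin n → ℂ) →ₗ[ℂ] (Fin n → ℂ))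
    (α β : Fin n → ℝ)
    (h : ∀ x, ∑ i, α i * Complex.normSq (L x i) = ∑ i, β i * Complex.normSq (M x i)) :
    (Finset.univ.filter fun i => α i < 0).card ≤ (Finset.univ.filter fun i => β i < 0).card := by
  by_contra! hlt
  let g : ({i // α i < 0} → ℂ) →ₗ[ℂ] ({j // β j < 0} → ℂ) :=
    (LinearMap.funLeft ℂ ℂ Subtype.val) ∘ₗ M ∘ₗ L.symm.toLinearMap ∘ₗ
      (Function.ExtendByZero.linearMap ℂ Subtype.val)
  have hk : LinearMap.ker g ≠ ⊥ := by
    apply LinearMap.ker_ne_bot_of_finrank_lt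
    simpa [Fintype.card_subtype] using hlt
  obtain ⟨c, hc, hc0⟩ := (Submodule.ne_bot_iff _).1 hk
  have hv : ∀ i : {i // α i < 0}, Function.extend Subtype.val c (0 : Fin n → ℂ) i = c i := fun i =>
    Subtype.val_injective.extend_apply _ _ _
  have hv' : ∀ i, ¬ α i < 0 → Function.extend Subtype.val c (0 : Fin n → ℂ) i = 0 := by
    intro i hi
    rw [Function.extend_apply']
    · rfl
    · rintro ⟨a, rfl⟩; exact hi a.2
  set y := Function.extend Subtype.val c (0 : Fin n → ℂ) with hy
  have h1 := h (L.symm y)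
  have hM : ∀ j, β j < 0 → M (L.symm y) j = 0 := by
    intro j hj
    exact congrFun (LinearMap.mem_ker.1 hc) ⟨j, hj⟩
  have h2 : 0 ≤ ∑ i, β i * Complex.normSq (M (L.symm y) i) := by
    refine Finset.sum_nonneg fun j _ => ?_
    by_cases hj : β j < 0
    · simp [hM j hj]
    · exact mul_nonneg (not_lt.1 hj) (Complex.normSq_nonneg _)
  rw [← h1] at h2
  obtain ⟨i, hi⟩ := Function.ne_iff.1 hc0
  have h3 : ∑ i, α i * Complex.normSq (L (L.symm y) i) < 0 := by
    simp only [LinearEquiv.apply_symm_apply]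
    refine Finset.sum_neg' (fun i _ => ?_) ⟨i, Finset.mem_univ _, ?_⟩
    · by_cases hj : α i < 0
      · exact mul_nonpos_of_nonpos_of_nonneg hj.le (Complex.normSq_nonneg _)
      · simp [hv' i hj]
    · rw [hv i]
      exact mul_neg_of_neg_of_pos i.2 (Complex.normSq_pos.2 hi)
  linarith

theorem dss_basis (n : ℕ) : ∀ (V : Type) [AddCommGroup V] [Module ℂ V] [FiniteDimensional ℂ V]
    (_ : Module.finrank ℂ V = n) (f : V →ₗ[ℂ] V) (h : V →ₗ⋆[ℂ] V →ₗ[ℂ] ℂ)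
    (_ : ∀ x y, h x y = star (h y x)) (_ : ∀ x, x ≠ 0 → (h x (f x)).re < 0),
    ∃ b : Module.Basis (Fin n) ℂ V, (∀ i j, i ≠ j → h (b i) (b j) = 0) ∧
      ∀ i j, j < i → h (b i) (f (b j)) = 0 := by
  induction n with
  | zero =>
    intro V _ _ _ hn f h _ _
    exact ⟨Module.finBasisOfFinrankEq ℂ V hn, fun i => i.elim0, fun i => i.elim0⟩
  | succ n ih =>
    intro V _ _ _ hn f h hs hneg
    have : Nontrivial V := Module.nontrivial_of_finrank_pos (R := ℂ) (by omega)
    obtain ⟨μ, hμ⟩ := Module.End.exists_eigenvalue f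
    obtain ⟨v, hv⟩ := hμ.exists_hasEigenvector
    have hfv : f v = μ • v := hv.apply_eq_smul
    have hvv : h v v ≠ 0 := by
      intro h0
      have := hneg v hv.2
      rw [hfv, map_smul, h0] at this
      simp at this
    let W := LinearMap.ker (h v)
    let π : V →ₗ[ℂ] W := LinearMap.codRestrict W (LinearMap.id - (LinearMap.toSpanSingleton ℂ V v) ∘ₗ ((h v v)⁻¹ • h v)) (by
      intro x
      simp [W]
      field_simp
      simp)
    have hπ : ∀ x, ∃ c : ℂ, x = (π x : V) + c • v := fun x => ⟨(h v v)⁻¹ * h v x, by simp [π]⟩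
    have hWv : ∀ w : W, h w v = 0 := by
      intro w
      rw [hs, LinearMap.mem_ker.1 w.2]; simp
    have hW : Module.finrank ℂ W = n := by
      have h1 := LinearMap.finrank_range_add_finrank_ker (h v)
      have h2 : LinearMap.range (h v) = ⊤ := by
        apply LinearMap.range_eq_top.2
        intro z
        exact ⟨(z * (h v v)⁻¹) • v, by simp [hvv]⟩
      rw [h2, finrank_top, hn] at h1
      simp at h1
      change Module.finrank ℂ (LinearMap.ker (h v)) = n
      omega
    have key : ∀ w : W, ∀ x, h w (π x) = h w x := by
      intro w x
      obtain ⟨c, hc⟩ := hπ x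
      conv_rhs => rw [hc]
      simp [hWv]
    obtain ⟨b, hb1, hb2⟩ := ih W hW (π ∘ₗ f ∘ₗ W.subtype)
      ((h.comp W.subtype).compl₂ W.subtype)
      (fun x y => hs x y) (by
        intro x hx
        have := hneg x (by simpa using hx)
        simpa [key] using this)
    simp [key] at hb1 hb2
    refine ⟨Module.Basis.mkFinCons v b ?_ ?_, ?_, ?_⟩
    · intro c x hx h0
      have h1 : h v (c • v + x) = 0 := by rw [h0]; simp
      rw [map_add, LinearMap.mem_ker.1 hx] at h1
      simpa [hvv] using h1
    · intro z
      obtain ⟨c, hc⟩ := hπ z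
      refine ⟨-c, ?_⟩
      have : z + -c • v = π z := by nth_rw 1 [hc]; simp
      rw [this]; exact (π z).2
    · intro i j hij
      rw [Module.Basis.coe_mkFinCons]
      induction i using Fin.cases <;> induction j using Fin.cases
      · exact absurd rfl hij
      · exact LinearMap.mem_ker.1 (b _).2
      · exact hWv _
      · exact hb1 _ _ (by simpa using hij)
    · intro i j hij
      rw [Module.Basis.coe_mkFinCons]
      induction i using Fin.cases <;> induction j using Fin.cases
      · exact absurd hij (lt_irrefl _)
      · exact absurd hij (by simp)
      · simp [hfv, hWv]
      · exact hb2 _ _ (by simpa using hij)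

theorem dss_re {n : ℕ} (M : Matrix (Fin n) (Fin n) ℝ) (x : Fin n → ℂ) (i : Fin n) :
    ((M.map Complex.ofReal *ᵥ x) i).re = (M *ᵥ fun k => (x k).re) i ∧
    ((M.map Complex.ofReal *ᵥ x) i).im = (M *ᵥ fun k => (x k).im) i := by
  simp [mulVec, dotProduct]

theorem dss_form {n : ℕ} (M : Matrix (Fin n) (Fin n) ℝ) (x : Fin n → ℂ) :
    (star x ⬝ᵥ (M.map Complex.ofReal *ᵥ x)).re = 
     (fun k => (x k).re) ⬝ᵥ (M *ᵥ fun k => (x k).re) + (fun k => (x k).im) ⬝ᵥ (M *ᵥ fun k => (x k).im) := by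
  rw [dotProduct, dotProduct, dotProduct, Complex.re_sum, ← Finset.sum_add_distrib]
  refine Finset.sum_congr rfl fun i _ => ?_
  rw [Complex.mul_re, (dss_re M x i).1, (dss_re M x i).2]
  simp

theorem dss_spec {n : ℕ} (P : Matrix (Fin n) (Fin n) ℝ) (hP : P.IsHermitian) : ∃ U : Matrix (Fin n) (Fin n) ℝ,
   ∀ x : Fin n → ℂ, (star x ⬝ᵥ (P.map Complex.ofReal *ᵥ x)).re = ∑ i, hP.eigenvalues i * Complex.normSq ((U.map Complex.ofReal).mulVecLin x i) := by
  refine ⟨(hP.eigenvectorUnitary : Matrix (Fin n) (Fin n) ℝ)ᵀ, fun x => ?_⟩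
  have key : ∀ u, u ⬝ᵥ (P *ᵥ u) = ∑ i, hP.eigenvalues i * ((hP.eigenvectorUnitary : Matrix (Fin n) (Fin n) ℝ)ᵀ *ᵥ u) i ^ 2 := by
    intro u
    have := hP.spectral_theorem
    rw [Unitary.conjStarAlgAut_apply] at this
    conv_lhs => rw [this]
    rw [← mulVec_mulVec, ← mulVec_mulVec, dotProduct_mulVec, ← mulVec_transpose]
    simp only [dotProduct, mulVec_diagonal, star_eq_conjTranspose, conjTranspose_eq_transpose_of_trivial]
    refine Finset.sum_congr rfl fun i _ => ?_
    simp; ring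
  rw [dss_form, key, key, ← Finset.sum_add_distrib]
  refine Finset.sum_congr rfl fun i _ => ?_
  rw [Complex.normSq_apply, mulVecLin_apply, (dss_re _ x i).1, (dss_re _ x i).2]
  ring

/-- Spectral splitting of dominant linear systems: if `P = Pᵀ` has exactly `p`
negative eigenvalues, no zero eigenvalue and `n − p` positive eigenvalues, and
`AᵀP + PA + 2γP ≺ 0`, then (counting the complex roots of the characteristic
polynomial with multiplicity) `A` has no eigenvalue with real part `−γ`,
exactly `p` eigenvalues with real part `> −γ` and exactly `n − p` eigenvalues
with real part `< −γ`. -/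
theorem dominant_spectral_splitting
    (n p : ℕ) (A : Matrix (Fin n) (Fin n) ℝ) (γ : ℝ) (hγ : 0 ≤ γ)
    (P : Matrix (Fin n) (Fin n) ℝ) (hP : P.IsHermitian)
    (hneg : (Finset.univ.filter fun i => hP.eigenvalues i < 0).card = p)
    (hzero : ∀ i, hP.eigenvalues i ≠ 0)
    (hpos : (Finset.univ.filter fun i => 0 < hP.eigenvalues i).card = n - p)
    (hLMI : (-(Aᵀ * P + P * A + (2 * γ) • P)).PosDef) :
    (∀ z ∈ (A.map (Complex.ofReal)).charpoly.roots, z.re ≠ -γ) ∧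
    ((A.map (Complex.ofReal)).charpoly.roots.filter fun z => -γ < z.re).card = p ∧
    ((A.map (Complex.ofReal)).charpoly.roots.filter fun z => z.re < -γ).card = n - p := by
  let h : (Fin n → ℂ) →ₗ⋆[ℂ] (Fin n → ℂ) →ₗ[ℂ] ℂ :=
    LinearMap.mk₂'ₛₗ (starRingEnd ℂ) (RingHom.id ℂ)
      (fun x y => star x ⬝ᵥ (P.map Complex.ofReal *ᵥ y))
      (by intros; simp [add_dotProduct]) (by intros; simp [smul_dotProduct])
      (by intros; simp [mulVec_add, dotProduct_add])
      (by intros; simp [mulVec_smul, dotProduct_smul])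
  have hh : ∀ x y, h x y = star x ⬝ᵥ (P.map Complex.ofReal *ᵥ y) := fun _ _ => rfl
  have hPC : (P.map Complex.ofReal)ᴴ = P.map Complex.ofReal := by
    ext i j
    have := hP.apply i j
    simp only [conjTranspose_apply, map_apply] at *
    simpa using this
  have hs : ∀ x y, h x y = star (h y x) := by
    intro x y
    rw [hh, hh, star_dotProduct, star_mulVec, hPC, ← dotProduct_mulVec]
  let T := toLin' (A.map Complex.ofReal)
  let f : (Fin n → ℂ) →ₗ[ℂ] (Fin n → ℂ) := T + (γ : ℂ) • LinearMap.id
  have hf : ∀ x y, h x (f y) = h x (T y) + γ * h x y := by intro x y; simp [f]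
  have hPT : Pᵀ = P := by simpa using hP.eq
  have hre : ∀ u : Fin n → ℝ, u ⬝ᵥ ((-(Aᵀ * P + P * A + (2 * γ) • P)) *ᵥ u)
      = -2 * (u ⬝ᵥ ((P * A + γ • P) *ᵥ u)) := by
    intro u
    have h1 : u ⬝ᵥ ((Aᵀ * P) *ᵥ u) = u ⬝ᵥ ((P * A) *ᵥ u) := by
      rw [dotProduct_mulVec, ← mulVec_transpose, transpose_mul, hPT, transpose_transpose,
        dotProduct_comm]
    simp only [neg_mulVec, add_mulVec, dotProduct_neg, dotProduct_add, h1, smul_mulVec,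
      dotProduct_smul, smul_eq_mul]
    ring
  have hnegU : ∀ u : Fin n → ℝ, u ≠ 0 → u ⬝ᵥ ((P * A + γ • P) *ᵥ u) < 0 := by
    intro u hu
    have := hLMI.dotProduct_mulVec_pos hu
    rw [star_trivial, hre] at this
    linarith
  have hnegU' : ∀ u : Fin n → ℝ, u ⬝ᵥ ((P * A + γ • P) *ᵥ u) ≤ 0 := by
    intro u
    by_cases hu : u = 0
    · simp [hu]
    · exact (hnegU u hu).le
  have hneg' : ∀ x, x ≠ 0 → (h x (f x)).re < 0 := by
    intro x hx
    have h1 : h x (f x) = star x ⬝ᵥ ((P * A + γ • P).map Complex.ofReal *ᵥ x) := by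
      have h2 : (P * A + γ • P).map Complex.ofReal
          = P.map Complex.ofReal * A.map Complex.ofReal + (γ : ℂ) • P.map Complex.ofReal := by
        ext i j
        simp [mul_apply]
      rw [hf, hh, hh, h2, add_mulVec, dotProduct_add, smul_mulVec, dotProduct_smul,
        ← mulVec_mulVec]
      rfl
    rw [h1, dss_form]
    by_cases hu : (fun k => (x k).re) = 0
    · have hv : (fun k => (x k).im) ≠ 0 := by
        intro hv
        apply hx
        ext k
        exact Complex.ext (congrFun hu k) (congrFun hv k)
      have := hnegU _ hv
      have := hnegU' (fun k => (x k).re)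
      linarith
    · have := hnegU _ hu
      have := hnegU' (fun k => (x k).im)
      linarith
  obtain ⟨b, hb1, hb2⟩ := dss_basis n (Fin n → ℂ) (by simp) f h hs hneg'
  have hrep : ∀ i x, h (b i) x = b.repr x i * h (b i) (b i) := by
    intro i x
    conv_lhs => rw [← b.sum_repr x]
    rw [map_sum, Finset.sum_eq_single i]
    · simp
    · intro j _ hj
      simp [hb1 i j hj.symm]
    · simp
  have him : ∀ x, (h x x).im = 0 := by
    intro x
    have := congrArg Complex.im (hs x x)
    simp at this
    linarith
  have hdiag : ∀ i, ((b.repr (T (b i)) i).re + γ) * (h (b i) (b i)).re < 0 := by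
    intro i
    have := hneg' (b i) (b.ne_zero i)
    rw [hf, hrep i (T (b i)), Complex.add_re, Complex.mul_re, Complex.mul_re, him] at this
    simp at this
    linarith
  have hne : ∀ i, h (b i) (b i) ≠ 0 := by
    intro i h0
    have := hdiag i
    rw [h0] at this
    simp at this
  have hup : (LinearMap.toMatrix b b T).IsUpperTriangular := by
    intro i j hij
    have hij : j < i := hij
    have h1 := hb2 i j hij
    rw [hf, hb1 i j hij.ne', hrep] at h1
    simpa [hne, LinearMap.toMatrix_apply] using h1
  have hchar : (A.map Complex.ofReal).charpoly.roots
      = Finset.univ.val.map fun i => b.repr (T (b i)) i := by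
    rw [← charpoly_toLin', ← LinearMap.charpoly_toMatrix _ b,
      charpoly_of_isUpperTriangular _ hup]
    rw [Polynomial.roots_prod _ _ (Finset.prod_ne_zero_iff.2 fun i _ => Polynomial.X_sub_C_ne_zero _)]
    simp [LinearMap.toMatrix_apply, Multiset.bind_singleton]
  obtain ⟨U, hU⟩ := dss_spec P hP
  have hsum : ∀ x, ∑ i, (h (b i) (b i)).re * Complex.normSq (b.equivFun x i)
      = ∑ i, hP.eigenvalues i * Complex.normSq ((U.map Complex.ofReal).mulVecLin x i) := by
    intro x
    rw [← hU, ← hh]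
    have h1 : h x x = ∑ i, star (b.repr x i) * h (b i) x := by
      have h2 : h x = ∑ i, star (b.repr x i) • h (b i) := by
        conv_lhs => rw [← b.sum_repr x]
        rw [map_sum]
        simp
      conv_lhs => rw [h2]
      simp
    rw [h1, Complex.re_sum]
    refine Finset.sum_congr rfl fun i _ => ?_
    rw [hrep i x, Complex.normSq_apply, ← mul_assoc, Complex.mul_re, him]
    simp
    ring
  have c1 := dss_pencil b.equivFun _ _ _ hsum
  have c2 := dss_pencil b.equivFun (U.map Complex.ofReal).mulVecLin
    (fun i => -(h (b i) (b i)).re) (fun i => -hP.eigenvalues i) (by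
      intro x
      simpa only [neg_mul, Finset.sum_neg_distrib, neg_inj] using hsum x)
  simp only [neg_lt_zero] at c2
  rw [hneg] at c1
  rw [hpos] at c2
  have e1 : ∀ i, -γ < (b.repr (T (b i)) i).re ↔ (h (b i) (b i)).re < 0 := by
    intro i
    have := hdiag i
    constructor
    · intro h1; by_contra! h2; nlinarith
    · intro h1; by_contra! h2; nlinarith
  have e2 : ∀ i, (b.repr (T (b i)) i).re < -γ ↔ 0 < (h (b i) (b i)).re := by
    intro i
    have := hdiag i
    constructor
    · intro h1; by_contra! h2; nlinarith
    · intro h1; by_contra! h2; nlinarith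
  have c3 : (Finset.univ.filter fun i => (h (b i) (b i)).re < 0).card
      + (Finset.univ.filter fun i => 0 < (h (b i) (b i)).re).card = n := by
    have h1 : (Finset.univ.filter fun i => 0 < (h (b i) (b i)).re)
        = Finset.univ.filter fun i => ¬ (h (b i) (b i)).re < 0 := by
      refine Finset.filter_congr fun i _ => ?_
      have := hdiag i
      constructor
      · intro h1; linarith
      · intro h1
        refine lt_of_le_of_ne (not_lt.1 h1) fun h0 => ?_
        rw [← h0] at this
        simp at this
    rw [h1, Finset.card_filter_add_card_filter_not]
    simp
  have hpn : p ≤ n := by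
    rw [← hneg]
    exact (Finset.card_le_univ _).trans (by simp)
  rw [hchar]
  refine ⟨?_, ?_, ?_⟩
  · intro z hz
    obtain ⟨i, _, rfl⟩ := Multiset.mem_map.1 hz
    intro h0
    have := hdiag i
    rw [h0] at this
    simp at this
  · rw [Multiset.filter_map, Multiset.card_map]
    have : (Multiset.filter ((fun z : ℂ => -γ < z.re) ∘ fun i => b.repr (T (b i)) i)
        (Finset.univ : Finset (Fin n)).val).card
        = (Finset.univ.filter fun i => (h (b i) (b i)).re < 0).card := by
      rw [← Finset.filter_congr fun i _ => e1 i]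
      rfl
    omega
  · rw [Multiset.filter_map, Multiset.card_map]
    have : (Multiset.filter ((fun z : ℂ => z.re < -γ) ∘ fun i => b.repr (T (b i)) i)
        (Finset.univ : Finset (Fin n)).val).card
        = (Finset.univ.filter fun i => 0 < (h (b i) (b i)).re).card := by
      rw [← Finset.filter_congr fun i _ => e2 i]
      rfl
    omega
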